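/- For t = 1 the Aluthge transform is exactly a weighted shift: Δ_1(S_λ) = S_μ, i.e. D(M_1 ∘ S_π ∘ M_0) = D(S_μ) and (M_1 ∘ S_π ∘ M_0) f = S_μ f for all f in this domain, where M_0 is the identity operator on ℓ²(V) and μ is taken with t = 1. -/

import Mathlib

open scoped ENNReal NNReal ComplexConjugate Classical ComplexInnerProductSpace

noncomputable section

/-- `HS V` is the Hilbert space `ℓ²(V)` of square-summable families of complex numbers
indexed by `V`. -/
abbrev HS (V : Type*) : Type _ := lp (fun _ : V => ℂ) 2

/-- A (possibly unbounded) partially defined operator in a Hilbert space `E`: a domain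
together with an assignment of values.  Only the restriction of `toFun` to `dom` is
relevant (e.g. via `POp.graph`). -/
structure POp (E : Type*) [NormedAddCommGroup E] [InnerProductSpace ℂ E] where
  dom : Set E
  toFun : E → E

namespace POp

variable {E : Type*} [NormedAddCommGroup E] [InnerProductSpace ℂ E]

/-- Composition of partially defined operators: `(A.comp B) f = A (B f)` on the natural
domain `{f ∈ dom B : B f ∈ dom A}`. -/
def comp (A B : POp E) : POp E :=
  ⟨{f | f ∈ B.dom ∧ B.toFun f ∈ A.dom}, fun f => A.toFun (B.toFun f)⟩

/-- The graph of a partially defined operator, as a subset of `E × E`. -/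
def graph (A : POp E) : Set (E × E) := {p | p.1 ∈ A.dom ∧ p.2 = A.toFun p.1}

/-- The Hilbert-space adjoint of a (densely defined) partially defined operator `A`:
`g ∈ dom A*` iff there is `h` with `⟪A f, g⟫ = ⟪f, h⟫` for all `f ∈ dom A`, and then
`A* g = h` (`h` is unique when `A` is densely defined). -/
def adj (A : POp E) : POp E :=
  ⟨{g | ∃ h : E, ∀ f ∈ A.dom, ⟪A.toFun f, g⟫ = ⟪f, h⟫},
   fun g => if h : ∃ h' : E, ∀ f ∈ A.dom, ⟪A.toFun f, g⟫ = ⟪f, h'⟫ then h.choose else 0⟩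

end POp

variable {V : Type*}

/-- The element of `ℓ²(V)` with coordinates `g` (junk value `0` if `g` is not
square-summable). -/
def mkH (g : V → ℂ) : HS V := if h : Memℓp g 2 then ⟨g, h⟩ else 0

/-- The standard orthonormal basis vector `e_u` of `ℓ²(V)`. -/
def eV (u : V) : HS V := mkH (fun v => if v = u then 1 else 0)

/-- The weighted shift `S_λ` on the directed tree encoded by the parent map `par`
(with `Chi(u) = {v : par v = u}`), with weights `lam`:
domain `{f : Σ_u (Σ_{v ∈ Chi(u)} |λ v|²)·|f u|² < ∞}` and value
`(S_λ f)(v) = λ v · f (par v)`. -/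
def shiftOp (par : V → V) (lam : V → ℂ) : POp (HS V) :=
  ⟨{f | ∑' u : V, ((∑' v : {v : V // par v = u}, ((‖lam v.1‖₊ : ℝ≥0∞) ^ 2)) *
        (‖f u‖₊ : ℝ≥0∞) ^ 2) < ⊤},
   fun f => mkH (fun v => lam v * f (par v))⟩

/-- `cW par lam u = (Σ_{v ∈ Chi(u)} |λ v|²)^{1/2}`, i.e. `c(u) = ‖S_λ e_u‖`. -/
def cW (par : V → V) (lam : V → ℂ) (u : V) : ℝ :=
  Real.sqrt (∑' v : {v : V // par v = u}, ‖lam v.1‖ ^ 2)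

/-- The multiplication operator `M_α` (representing `|S_λ|^α`): domain
`{f : Σ_u c(u)^{2α}·|f u|² < ∞}` and `(M_α f)(u) = c(u)^α·f(u)`. -/
def mulOp (par : V → V) (lam : V → ℂ) (α : ℝ) : POp (HS V) :=
  ⟨{f | Summable fun u : V => cW par lam u ^ (2 * α) * ‖f u‖ ^ 2},
   fun f => mkH (fun u => ((cW par lam u ^ α : ℝ) : ℂ) * f u)⟩

/-- The weights `π` of the partial isometry in the polar decomposition of `S_λ`:
`π v = λ v / c(par v)` if `c(par v) > 0`, and `π v = 0` otherwise. -/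
def piW (par : V → V) (lam : V → ℂ) (v : V) : ℂ :=
  if 0 < cW par lam (par v) then lam v / ((cW par lam (par v) : ℝ) : ℂ) else 0

/-- The partial isometry `S_π` of the polar decomposition of `S_λ`
(a contraction defined on all of `ℓ²(V)`). -/
def piOp (par : V → V) (lam : V → ℂ) : POp (HS V) :=
  ⟨Set.univ, fun f => mkH (fun v => piW par lam v * f (par v))⟩

/-- The weights `μ`: `μ v = (c v / c (par v))^t · λ v` if `c (par v) > 0`, else `0`. -/
def muW (par : V → V) (lam : V → ℂ) (t : ℝ) (v : V) : ℂ :=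
  if 0 < cW par lam (par v)
  then (((cW par lam v / cW par lam (par v)) ^ t : ℝ) : ℂ) * lam v else 0

/-- The `t`-Aluthge transform `Δ_t(S_λ) = M_t ∘ S_π ∘ M_{1-t} = |S_λ|^t S_π |S_λ|^{1-t}`. -/
def aluthge (par : V → V) (lam : V → ℂ) (t : ℝ) : POp (HS V) :=
  ((mulOp par lam t).comp (piOp par lam)).comp (mulOp par lam (1 - t))

theorem memℓp_two_iff_tsum_lt_top {g : V → ℂ} :
    Memℓp g 2 ↔ ∑' v, (‖g v‖₊ : ℝ≥0∞) ^ 2 < ⊤ := by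
  rw [memℓp_gen_iff (by norm_num), lt_top_iff_ne_top]
  have h : ∀ v, (‖g v‖₊ : ℝ≥0∞) ^ 2 = ((‖g v‖₊ ^ 2 : ℝ≥0) : ℝ≥0∞) := fun v => by push_cast; rfl
  simp_rw [h]
  rw [ENNReal.tsum_coe_ne_top_iff_summable, ← NNReal.summable_coe]
  simp

theorem tsum_fiberwise (par : V → V) (F : V → ℝ≥0∞) :
    ∑' v, F v = ∑' u, ∑' v : {v : V // par v = u}, F v.1 := by
  rw [← (Equiv.sigmaFiberEquiv par).tsum_eq F, ENNReal.tsum_sigma']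
  rfl

theorem tsum_nnnorm_mul_comp_sq (par : V → V) (w f : V → ℂ) :
    ∑' v, (‖w v * f (par v)‖₊ : ℝ≥0∞) ^ 2 =
      ∑' u, (∑' v : {v : V // par v = u}, (‖w v.1‖₊ : ℝ≥0∞) ^ 2) * (‖f u‖₊ : ℝ≥0∞) ^ 2 := by
  rw [tsum_fiberwise par]
  refine tsum_congr fun u => ?_
  rw [← ENNReal.tsum_mul_right]
  refine tsum_congr fun v => ?_
  rw [v.2, nnnorm_mul, ENNReal.coe_mul, mul_pow]

theorem mem_shiftOp_dom_iff {par : V → V} {w : V → ℂ} {f : HS V} :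
    f ∈ (shiftOp par w).dom ↔ Memℓp (fun v => w v * f (par v)) 2 := by
  rw [memℓp_two_iff_tsum_lt_top, tsum_nnnorm_mul_comp_sq]
  rfl

theorem cW_nonneg (par : V → V) (lam : V → ℂ) (u : V) : 0 ≤ cW par lam u :=
  Real.sqrt_nonneg _

theorem mem_mulOp_one_dom_iff {par : V → V} {lam : V → ℂ} {f : HS V} :
    f ∈ (mulOp par lam 1).dom ↔ Memℓp (fun u => (cW par lam u : ℂ) * f u) 2 := by
  rw [memℓp_gen_iff (by norm_num)]
  refine iff_of_eq (congrArg Summable (funext fun u => ?_))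
  simp [mul_pow]

theorem tsum_nnnorm_piW_sq_le_one (par : V → V) (lam : V → ℂ)
    (hl : ∀ u : V, Summable fun v : {v : V // par v = u} => ‖lam v.1‖ ^ 2) (u : V) :
    ∑' v : {v : V // par v = u}, (‖piW par lam v.1‖₊ : ℝ≥0∞) ^ 2 ≤ 1 := by
  have key : ∀ v : {v : V // par v = u}, (‖piW par lam v.1‖₊ : ℝ≥0∞) ^ 2 =
      ENNReal.ofReal (‖lam v.1‖ ^ 2 / cW par lam u ^ 2) := by
    rintro ⟨v, rfl⟩
    rw [← enorm_eq_nnnorm, ← ofReal_norm, ← ENNReal.ofReal_pow (norm_nonneg _)]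
    by_cases h : 0 < cW par lam (par v)
    · simp [piW, h, div_pow]
    · simp [piW, le_antisymm (not_lt.1 h) (cW_nonneg par lam (par v))]
  simp_rw [key]
  rw [← ENNReal.ofReal_tsum_of_nonneg (fun v => by positivity) ((hl u).div_const _),
    tsum_div_const, cW, Real.sq_sqrt (tsum_nonneg fun v => by positivity)]
  exact ENNReal.ofReal_le_one.2 (div_self_le_one _)

theorem memℓp_piW_mul (par : V → V) (lam : V → ℂ)
    (hl : ∀ u : V, Summable fun v : {v : V // par v = u} => ‖lam v.1‖ ^ 2) (f : HS V) :
    Memℓp (fun v => piW par lam v * f (par v)) 2 := by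
  rw [memℓp_two_iff_tsum_lt_top, tsum_nnnorm_mul_comp_sq]
  refine lt_of_le_of_lt (ENNReal.tsum_le_tsum fun u => ?_)
    (memℓp_two_iff_tsum_lt_top.1 (lp.memℓp f))
  exact mul_le_of_le_one_left' (tsum_nnnorm_piW_sq_le_one par lam hl u)

theorem mkH_apply {g : V → ℂ} (hg : Memℓp g 2) (v : V) : mkH g v = g v := by
  rw [mkH, dif_pos hg]

theorem cW_mul_piW (par : V → V) (lam : V → ℂ) (v : V) :
    (cW par lam v : ℂ) * piW par lam v = muW par lam 1 v := by
  unfold piW muW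
  split_ifs
  · rw [Real.rpow_one]
    push_cast
    ring
  · exact mul_zero _

/-- Remark 4.3: for `t = 1` the Aluthge transform is exactly a weighted
shift: `Δ_1(S_λ) = M_1 ∘ S_π ∘ M_0 = S_μ` (with `M_0` the identity operator on `ℓ²(V)`
and `μ` taken with `t = 1`): equal domains and equal values. -/
theorem statement_6 (V : Type*) [Nonempty V] (par : V → V)
    (ha : ∀ u v : V, ∃ m n : ℕ, par^[m] u = par^[n] v)
    (hb : ∀ (v : V) (n : ℕ), 1 ≤ n → par^[n] v ≠ v)
    (lam : V → ℂ)
    (hl : ∀ u : V, Summable fun v : {v : V // par v = u} => ‖lam v.1‖ ^ 2) :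
    (((mulOp par lam 1).comp (piOp par lam)).comp
        (⟨Set.univ, fun f => f⟩ : POp (HS V))).dom
      = (shiftOp par (muW par lam 1)).dom ∧
    ∀ f ∈ (((mulOp par lam 1).comp (piOp par lam)).comp
        (⟨Set.univ, fun f => f⟩ : POp (HS V))).dom,
      (((mulOp par lam 1).comp (piOp par lam)).comp
          (⟨Set.univ, fun f => f⟩ : POp (HS V))).toFun f
        = (shiftOp par (muW par lam 1)).toFun f := by
  have hpi : ∀ (f : HS V) (v : V), (cW par lam v : ℂ) * (piOp par lam).toFun f v =
      muW par lam 1 v * f (par v) := fun f v => by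
    rw [piOp, mkH_apply (memℓp_piW_mul par lam hl f), ← mul_assoc, cW_mul_piW]
  refine ⟨Set.ext fun f => ?_, fun f _ => ?_⟩
  · have h : (piOp par lam).toFun f ∈ (mulOp par lam 1).dom ↔
        f ∈ (shiftOp par (muW par lam 1)).dom := by
      rw [mem_mulOp_one_dom_iff, mem_shiftOp_dom_iff]
      simp_rw [hpi]
    simpa [POp.comp, piOp] using h
  · refine congrArg mkH (funext fun v => ?_)
    rw [Real.rpow_one]
    exact hpi f v
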